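/- Let K be a field, S a positive normal affine semigroup with gp(S) = ℤ^r, support forms σ_1,…,σ_s, and R = K[S]. Let c, d ∈ Cl(R) = ℤ^s/σ(ℤ^r) and suppose c is not a torsion element. Then lim_{j→∞} μ(D(a_j)) = ∞ for any choice of representatives a_j ∈ ℤ^s of the classes jc + d, j ∈ ℕ. -/

import Mathlib

set_option synthInstance.maxHeartbeats 1000000
set_option maxHeartbeats 1000000

open scoped BigOperators

noncomputable section

/-- Pairing of an integral linear form (given by its coefficient vector `f`) with `x`. -/
def lin {r : ℕ} (f x : Fin r → ℤ) : ℤ := ∑ k, f k * x k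

lemma lin_zero {r : ℕ} (f : Fin r → ℤ) : lin f 0 = 0 := by simp [lin]

lemma lin_add {r : ℕ} (f x y : Fin r → ℤ) : lin f (x + y) = lin f x + lin f y := by
  simp [lin, mul_add, Finset.sum_add_distrib]

/-- A family of integral linear forms, bundled as an additive homomorphism `ℤ^r → ℤ^s`. -/
def formsHom {r s : ℕ} (σ : Fin s → Fin r → ℤ) : (Fin r → ℤ) →+ (Fin s → ℤ) where
  toFun x i := lin (σ i) x
  map_zero' := by funext i; simp [lin_zero]
  map_add' x y := by funext i; simp [lin_add]

/-- The subgroup `σ(ℤ^r) ⊆ ℤ^s`. -/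
def formsRange {r s : ℕ} (σ : Fin s → Fin r → ℤ) : AddSubgroup (Fin s → ℤ) :=
  (formsHom σ).range

/-- The divisor class group `Cl(R) = ℤ^s / σ(ℤ^r)`. -/
abbrev classGroup {r s : ℕ} (σ : Fin s → Fin r → ℤ) : Type :=
  (Fin s → ℤ) ⧸ formsRange σ

/-- The set of solutions of the inhomogeneous system of inequalities `σ_i(x) ≥ a_i`. -/
def Tset {r s : ℕ} (σ : Fin s → Fin r → ℤ) (a : Fin s → ℤ) : Set (Fin r → ℤ) :=
  {x | ∀ i, a i ≤ lin (σ i) x}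

lemma lin_sub {r : ℕ} (f x y : Fin r → ℤ) : lin f (x - y) = lin f x - lin f y := by
  simp [lin, mul_sub, Finset.sum_sub_distrib]

lemma lin_smul {r : ℕ} (f : Fin r → ℤ) (m : ℤ) (x : Fin r → ℤ) : lin f (m • x) = m * lin f x := by
  simp [lin, Finset.mul_sum, mul_left_comm]

lemma lin_sum {r : ℕ} {ι : Type*} (f : Fin r → ℤ) (t : Finset ι) (x : ι → Fin r → ℤ) :
    lin f (∑ k ∈ t, x k) = ∑ k ∈ t, lin f (x k) := by
  simp only [lin, Finset.sum_apply, Finset.mul_sum]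
  exact Finset.sum_comm

/-- The semigroup contains an element on which every support form is positive. -/
lemma exists_forall_lin_pos {r s : ℕ} (S : AddSubmonoid (Fin r → ℤ)) (σ : Fin s → Fin r → ℤ)
    (hSgp : ∀ x : Fin r → ℤ, ∃ a ∈ S, ∃ b ∈ S, x = a - b)
    (hrep : ∀ x : Fin r → ℤ, x ∈ S ↔ ∀ i, 0 ≤ lin (σ i) x)
    (hneg : ∀ i, ∃ x : Fin r → ℤ, lin (σ i) x < 0) :
    ∃ w : Fin r → ℤ, ∀ i, 0 < lin (σ i) w := by
  have hpos : ∀ i, ∃ y ∈ S, 0 < lin (σ i) y := by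
    intro i
    obtain ⟨x, hx⟩ := hneg i
    obtain ⟨p, hp, q, hq, rfl⟩ := hSgp x
    have := (hrep p).1 hp i
    rw [lin_sub] at hx
    exact ⟨q, hq, by linarith⟩
  choose y hyS hy using hpos
  refine ⟨∑ i, y i, fun i => ?_⟩
  rw [lin_sum]
  exact Finset.sum_pos' (fun k _ => (hrep _).1 (hyS k) i) ⟨i, Finset.mem_univ i, hy i⟩

lemma Tset_nonempty {r s : ℕ} (σ : Fin s → Fin r → ℤ) {w : Fin r → ℤ}
    (hw : ∀ i, 0 < lin (σ i) w) (a : Fin s → ℤ) : (Tset σ a).Nonempty := by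
  refine ⟨(∑ i, |a i|) • w, fun i => ?_⟩
  rw [lin_smul]
  have h1 : |a i| ≤ ∑ k, |a k| :=
    Finset.single_le_sum (f := fun k => |a k|) (fun k _ => abs_nonneg (a k)) (Finset.mem_univ i)
  have h2 := le_abs_self (a i)
  have h3 := abs_nonneg (a i)
  nlinarith [hw i]

/-- The sum of the support forms attains its minimum on every nonempty `T(a)`. -/
lemma exists_isMin_sum_lin {r s : ℕ} (σ : Fin s → Fin r → ℤ) (a : Fin s → ℤ)
    (hne : (Tset σ a).Nonempty) :
    ∃ u ∈ Tset σ a, ∀ y ∈ Tset σ a, ∑ k, lin (σ k) u ≤ ∑ k, lin (σ k) y := by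
  obtain ⟨y₀, hy₀⟩ := hne
  obtain ⟨m, ⟨u, hu, rfl⟩, hmin⟩ := Int.exists_least_of_bdd
    (P := fun z => ∃ y ∈ Tset σ a, ∑ k, lin (σ k) y = z)
    ⟨∑ k, a k, by rintro z ⟨y, hy, rfl⟩; exact Finset.sum_le_sum fun k _ => hy k⟩
    ⟨_, y₀, hy₀, rfl⟩
  exact ⟨u, hu, fun y hy => hmin _ ⟨y, hy, rfl⟩⟩

/-- Along a progression with non-torsion difference, for all but finitely many `j` every point of
`T(a_j)` is far from one of the facets. -/
lemma exists_forall_far_from_facet {r s : ℕ} (σ : Fin s → Fin r → ℤ) (c d : classGroup σ)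
    (hc : ∀ k : ℕ, 0 < k → k • c ≠ 0) (a : ℕ → Fin s → ℤ)
    (ha : ∀ j : ℕ, QuotientAddGroup.mk' (formsRange σ) (a j) = j • c + d) (M : ℤ) :
    ∃ N : ℕ, ∀ j ≥ N, ∀ u ∈ Tset σ (a j), ∃ i, M ≤ lin (σ i) u - a j i := by
  have hinj : Function.Injective fun j : ℕ => j • c + d := by
    have key : ∀ j k : ℕ, j < k → j • c + d ≠ k • c + d := by
      intro j k hjk h
      obtain ⟨l, rfl⟩ := Nat.exists_eq_add_of_lt hjk
      refine hc (l + 1) l.succ_pos ?_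
      have h' := add_right_cancel h
      rw [add_assoc, add_nsmul] at h'
      exact left_eq_add.1 h'
    intro j k h
    rcases lt_trichotomy j k with hlt | heq | hgt
    · exact absurd h (key j k hlt)
    · exact heq
    · exact absurd h.symm (key k j hgt)
  have hfin : {j : ℕ | ∃ u ∈ Tset σ (a j), ∀ i, lin (σ i) u - a j i < M}.Finite := by
    refine Set.Finite.of_finite_image (f := fun j : ℕ => j • c + d) ?_ hinj.injOn
    refine ((Set.finite_Icc (0 : Fin s → ℤ) (fun _ => M)).image
      (fun b => -QuotientAddGroup.mk' (formsRange σ) b)).subset ?_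
    rintro _ ⟨j, ⟨u, hu, hlt⟩, rfl⟩
    refine ⟨formsHom σ u - a j, ⟨fun i => sub_nonneg.2 (hu i), fun i => (hlt i).le⟩, ?_⟩
    have h0 : QuotientAddGroup.mk' (formsRange σ) (formsHom σ u) = 0 :=
      (QuotientAddGroup.eq_zero_iff _).2 ⟨u, rfl⟩
    simp only [map_sub, h0, ha, zero_sub, neg_neg]
  obtain ⟨N, hN⟩ := hfin.bddAbove
  refine ⟨N + 1, fun j hj u hu => ?_⟩
  by_contra! h
  have := hN ⟨u, hu, h⟩
  omega

/-- If `u` minimizes the sum of the support forms on `T(a)` and two points `u + m • h`,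
`u + m' • h` lie in a common translate `y + S` with `y ∈ T(a)`, then `m` is at most a constant
multiple of `m'`. -/
lemma mul_le_mul_of_common_divisor {r s : ℕ} (σ : Fin s → Fin r → ℤ) {a : Fin s → ℤ}
    {u y h : Fin r → ℤ} (hmin : ∀ z ∈ Tset σ a, ∑ k, lin (σ k) u ≤ ∑ k, lin (σ k) z)
    (hy : y ∈ Tset σ a) (i : Fin s) {m m' : ℤ}
    (hm : lin (σ i) y ≤ lin (σ i) (u + m • h))
    (hm' : ∀ k, lin (σ k) y ≤ lin (σ k) (u + m' • h)) :
    m * -lin (σ i) h ≤ m' * (-lin (σ i) h + ∑ k, lin (σ k) h) := by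
  have h1 : lin (σ i) (u + m' • h) - lin (σ i) y ≤
      ∑ k, (lin (σ k) (u + m' • h) - lin (σ k) y) :=
    Finset.single_le_sum (f := fun k => lin (σ k) (u + m' • h) - lin (σ k) y)
      (fun k _ => sub_nonneg.2 (hm' k)) (Finset.mem_univ i)
  have h2 := hmin y hy
  simp only [lin_add, lin_smul, Finset.sum_sub_distrib, Finset.sum_add_distrib,
    ← Finset.mul_sum] at h1 hm
  linarith

/-- Theorem: growth of `μ` along arithmetic progressions.
Let `c, d ∈ Cl(R) = ℤ^s/σ(ℤ^r)` with `c` not a torsion element.  Then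
`μ(D(a_j)) → ∞` for any representatives `a_j` of the classes `j•c + d`; i.e. for every
bound `C` there is `N` such that for `j ≥ N` the set `T(a_j)` is not a union of at most
`C` translates `x_i + S` with `x_i ∈ T(a_j)`. -/
theorem mu_tendsto_infinity_on_arithmetic_progression
    {r s : ℕ}
    (S : AddSubmonoid (Fin r → ℤ)) (σ : Fin s → Fin r → ℤ)
    (hSfg : S.FG)
    (hSpos : ∀ x ∈ S, -x ∈ S → x = 0)
    (hSgp : ∀ x : Fin r → ℤ, ∃ a ∈ S, ∃ b ∈ S, x = a - b)
    (hrep : ∀ x : Fin r → ℤ, x ∈ S ↔ ∀ i, 0 ≤ lin (σ i) x)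
    (hirr : ∀ j, ∃ x : Fin r → ℤ, lin (σ j) x < 0 ∧ ∀ i, i ≠ j → 0 ≤ lin (σ i) x)
    (hprim : ∀ i, Finset.univ.gcd (σ i) = 1)
    (c d : classGroup σ)
    (hc : ∀ k : ℕ, 0 < k → k • c ≠ 0)
    (a : ℕ → Fin s → ℤ)
    (ha : ∀ j : ℕ, QuotientAddGroup.mk' (formsRange σ) (a j) = j • c + d) :
    ∀ C : ℕ, ∃ N : ℕ, ∀ j ≥ N,
      ¬ ∃ (g : ℕ) (x : Fin g → Fin r → ℤ), g ≤ C ∧ (∀ i, x i ∈ Tset σ (a j)) ∧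
        Tset σ (a j) = ⋃ i, (fun y => x i + y) '' (S : Set (Fin r → ℤ)) := by
  intro C
  choose h hneg hnonneg using hirr
  obtain ⟨w, hw⟩ := exists_forall_lin_pos S σ hSgp hrep fun i => ⟨h i, hneg i⟩
  obtain ⟨B, hB⟩ : ∃ B : ℤ, ∀ i, -lin (σ i) (h i) + |∑ k, lin (σ k) (h i)| < B := by
    obtain ⟨B, hB⟩ := (Set.finite_range
      fun i => -lin (σ i) (h i) + |∑ k, lin (σ k) (h i)|).bddAbove
    exact ⟨B + 1, fun i => Int.lt_add_one_of_le (hB ⟨i, rfl⟩)⟩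
  obtain ⟨N, hN⟩ := exists_forall_far_from_facet σ c d hc a ha (B * B ^ C)
  refine ⟨N, fun j hj => ?_⟩
  rintro ⟨g, x, hg, hx, hcov⟩
  obtain ⟨u, hu, hmin⟩ := exists_isMin_sum_lin σ (a j) (Tset_nonempty σ hw (a j))
  obtain ⟨i, hi⟩ := hN j hj u hu
  have hBi := hB i
  have hni := hneg i
  have hθ := abs_nonneg (∑ k, lin (σ k) (h i))
  have hB1 : 1 ≤ B := by linarith
  have hmem : ∀ m : Fin (C + 1), u + B ^ (m : ℕ) • h i ∈ Tset σ (a j) := by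
    intro m k
    have hpow : B ^ (m : ℕ) ≤ B ^ C := pow_le_pow_right₀ hB1 (by omega)
    have hpos : 0 < B ^ (m : ℕ) := by positivity
    have hk := hu k
    rw [lin_add, lin_smul]
    by_cases hki : k = i
    · subst hki
      nlinarith
    · have := mul_nonneg hpos.le (hnonneg i k hki)
      linarith
  have hdiv : ∀ m : Fin (C + 1), ∃ l : Fin g, ∀ k,
      lin (σ k) (x l) ≤ lin (σ k) (u + B ^ (m : ℕ) • h i) := by
    intro m
    have hm := hmem m
    rw [hcov] at hm
    obtain ⟨l, y, hyS, hy⟩ := Set.mem_iUnion.1 hm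
    refine ⟨l, fun k => ?_⟩
    rw [← hy]
    simp only [lin_add]
    linarith [(hrep y).1 hyS k]
  choose l hl using hdiv
  obtain ⟨m₁, m₂, hne, heq⟩ := Fintype.exists_ne_map_eq_of_card_lt l (by simp; omega)
  wlog hlt : m₁ < m₂ generalizing m₁ m₂
  · exact this m₂ m₁ hne.symm heq.symm (lt_of_le_of_ne (not_lt.1 hlt) hne.symm)
  have hle := mul_le_mul_of_common_divisor σ hmin (hx (l m₁)) i (heq ▸ hl m₂ i) (hl m₁)
  have hpow : B ^ (m₁ : ℕ) * B ≤ B ^ (m₂ : ℕ) := by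
    rw [← pow_succ]
    exact pow_le_pow_right₀ hB1 hlt
  have hpos : 0 < B ^ (m₁ : ℕ) := by positivity
  have hlt' : -lin (σ i) (h i) + ∑ k, lin (σ k) (h i) < B := by
    linarith [le_abs_self (∑ k, lin (σ k) (h i))]
  have h1 := mul_lt_mul_of_pos_left hlt' hpos
  have hpos₂ : 0 < B ^ (m₂ : ℕ) := by positivity
  nlinarith
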